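/- Let f_1,…,f_m ∈ ℂ[x_1,…,x_n] be nonzero, pairwise coprime homogeneous polynomials of positive degree with m > n, and let p ∈ R = ℂ[x_1,…,x_n] be a nonzero element such that the localization M(A)[p^{-1}] of the likelihood module is a free module over R[p^{-1}]. Then the likelihood ideal is the saturation of the pre-likelihood ideal at p: I(A) = I_0(A) : p^∞ = {g ∈ ℂ[x,s] : p^k·g ∈ I_0(A) for some k ≥ 0}. -/

import Mathlib

open MvPolynomial

noncomputable section

/-- The polynomial ring `R = ℂ[x_1,…,x_n]`. -/
abbrev PolyR (n : ℕ) : Type := MvPolynomial (Fin n) ℂ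

/-- The polynomial ring `ℂ[x_1,…,x_n,s_i : i ∈ ι]`. -/
abbrev PolyRS (n : ℕ) (ι : Type) : Type := MvPolynomial (Fin n ⊕ ι) ℂ

variable {n : ℕ} {ι : Type} [Fintype ι]

/-- The `R`-linear map given by the matrix `Q`, sending `(a, b)` to the vector with
`i`-th entry `a_i f_i + Σ_j b_j ∂f_i/∂x_j`. -/
def Qmap (f : ι → PolyR n) :
    ((ι → PolyR n) × (Fin n → PolyR n)) →ₗ[PolyR n] (ι → PolyR n) where
  toFun ab := fun i => ab.1 i * f i + ∑ j, ab.2 j * pderiv j (f i)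
  map_add' x y := by
    funext i
    simp only [Prod.fst_add, Prod.snd_add, Pi.add_apply, add_mul, Finset.sum_add_distrib]
    ring
  map_smul' r x := by
    funext i
    simp only [Prod.smul_fst, Prod.smul_snd, Pi.smul_apply, smul_eq_mul, RingHom.id_apply,
      mul_assoc, ← Finset.mul_sum]
    ring

/-- The `R`-linear map given by the Jacobian matrix `Jac(F)`. -/
def jacMap (f : ι → PolyR n) : (Fin n → PolyR n) →ₗ[PolyR n] (ι → PolyR n) where
  toFun b := fun i => ∑ j, b j * pderiv j (f i)
  map_add' x y := by
    funext i
    simp only [Pi.add_apply, add_mul, Finset.sum_add_distrib]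
  map_smul' r x := by
    funext i
    simp only [Pi.smul_apply, smul_eq_mul, RingHom.id_apply, mul_assoc, ← Finset.mul_sum]

/-- The log-derivation module `logDer(A) ⊆ R^m`. -/
def logDer (f : ι → PolyR n) : Submodule (PolyR n) (ι → PolyR n) where
  carrier := {a | ∃ b : Fin n → PolyR n, ∀ i, a i * f i + ∑ j, b j * pderiv j (f i) = 0}
  zero_mem' := ⟨0, fun i => by simp⟩
  add_mem' := by
    rintro a a' ⟨b, hb⟩ ⟨b', hb'⟩
    refine ⟨b + b', fun i => ?_⟩
    have h1 := hb i
    have h2 := hb' i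
    simp only [Pi.add_apply, add_mul, Finset.sum_add_distrib]
    linear_combination h1 + h2
  smul_mem' := by
    rintro c a ⟨b, hb⟩
    refine ⟨c • b, fun i => ?_⟩
    have h1 := hb i
    simp only [Pi.smul_apply, smul_eq_mul, mul_assoc, ← Finset.mul_sum]
    linear_combination c * h1

/-- The pre-likelihood ideal `I₀(A) ⊆ ℂ[x,s]`, generated by the polynomials
`Σ_i a_i s_i` for `a ∈ logDer(A)`. -/
def preLikelihoodIdeal (f : ι → PolyR n) : Ideal (PolyRS n ι) :=
  Ideal.span {g | ∃ a ∈ logDer f, g = ∑ i, rename Sum.inl (a i) * X (Sum.inr i)}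

/-- The Jacobian matrix of `F = (f_1,…,f_m)` evaluated at a point `x ∈ ℂ^n`. -/
def jacAt (f : ι → PolyR n) (x : Fin n → ℂ) : Matrix ι (Fin n) ℂ :=
  Matrix.of fun i j => eval x (pderiv j (f i))

/-- The maximal rank of the Jacobian matrix over all points of `ℂ^n`. -/
def jacMaxRank (f : ι → PolyR n) : ℕ :=
  ⨆ x : Fin n → ℂ, (jacAt f x).rank

/-- The critical-point locus of the log-likelihood `ℓ_A = Σ_j s_j log f_j`,
with denominators cleared, together with the maximal-rank regularity condition. -/
def critLocus [DecidableEq ι] (f : ι → PolyR n) : Set ((Fin n → ℂ) × (ι → ℂ)) :=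
  {p | (∀ j, eval p.1 (f j) ≠ 0) ∧ (jacAt f p.1).rank = jacMaxRank f ∧
    ∀ i : Fin n, ∑ j, p.2 j * eval p.1 (pderiv i (f j)) *
      ∏ k ∈ Finset.univ.erase j, eval p.1 (f k) = 0}

/-- The likelihood ideal `I(A)`: all polynomials in `ℂ[x,s]` vanishing on the
critical-point locus. -/
def likelihoodIdeal [DecidableEq ι] (f : ι → PolyR n) : Ideal (PolyRS n ι) where
  carrier := {g | ∀ p ∈ critLocus f, eval (Sum.elim p.1 p.2) g = 0}
  zero_mem' := fun p _ => by simp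
  add_mem' := fun {a b} ha hb p hp => by simp [map_add, ha p hp, hb p hp]
  smul_mem' := fun c g hg p hp => by simp [smul_eq_mul, hg p hp]

/-- An arrangement is gentle if its pre-likelihood ideal equals its likelihood ideal. -/
def IsGentle [DecidableEq ι] (f : ι → PolyR n) : Prop :=
  preLikelihoodIdeal f = likelihoodIdeal f

/-- The module `Der(A)` of `A`-derivations: derivations `θ` with `θ(f) ∈ ⟨f⟩`,
where `f = f_1 ⋯ f_m`. -/
def DerA (f : ι → PolyR n) : Submodule (PolyR n) (Derivation ℂ (PolyR n) (PolyR n)) where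
  carrier := {θ | θ (∏ i, f i) ∈ Ideal.span {∏ i, f i}}
  zero_mem' := by simp
  add_mem' := by
    intro a b ha hb
    simpa using Ideal.add_mem _ ha hb
  smul_mem' := by
    intro c θ hθ
    simpa [smul_eq_mul] using Ideal.mul_mem_left _ c hθ


theorem MvPolynomial.eval_aeval_eq {σ τ : Type*} (φ : σ → MvPolynomial τ ℂ) (y : τ → ℂ)
    (g : MvPolynomial σ ℂ) : eval y (aeval φ g) = eval (fun i => eval y (φ i)) g := by
  induction g using MvPolynomial.induction_on with
  | C a => simp
  | add a b ha hb => simp only [map_add, ha, hb]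
  | mul_X a i ha => simp only [map_mul, ha, aeval_X, eval_X]

theorem MvPolynomial.eq_zero_of_eval_eq_zero_of_ne {σ : Type*} {q g : MvPolynomial σ ℂ}
    (hq : q ≠ 0) (h : ∀ y, eval y q ≠ 0 → eval y g = 0) : g = 0 := by
  have hqg : q * g = 0 := MvPolynomial.funext fun y => by
    by_cases hy : eval y q = 0
    · simp [hy]
    · simp [h y hy]
  exact (mul_eq_zero.mp hqg).resolve_left hq

/-- Every matrix over a field has a reflexive generalized inverse. -/
theorem Matrix.exists_reflexive_inverse {K α β : Type*} [Field K] [Fintype α] [Fintype β]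
    (A : Matrix α β K) : ∃ B : Matrix β α K, A * B * A = A ∧ B * A * B = B := by
  classical
  suffices h : ∃ B : Matrix β α K, A * B * A = A by
    obtain ⟨B, hB⟩ := h
    have hBA : A * (B * A) = A := by rw [← Matrix.mul_assoc, hB]
    refine ⟨B * A * B, ?_, ?_⟩ <;> simp only [Matrix.mul_assoc, hBA]
    rw [← Matrix.mul_assoc A B (A * B), ← Matrix.mul_assoc (A * B) A B, hB]
  obtain ⟨s, hs⟩ := A.toLin'.rangeRestrict.exists_rightInverse_of_surjective
    (LinearMap.range_rangeRestrict _)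
  obtain ⟨t, ht⟩ := s.exists_extend
  refine ⟨LinearMap.toMatrix' t, ?_⟩
  apply Matrix.toLin'.injective
  ext1 v
  rw [Matrix.toLin'_mul, Matrix.toLin'_mul, Matrix.toLin'_toMatrix']
  have h1 := LinearMap.congr_fun ht (A.toLin'.rangeRestrict (LinearMap.single K _ v 1))
  have h2 := LinearMap.congr_fun hs (A.toLin'.rangeRestrict (LinearMap.single K _ v 1))
  have h3 := congrArg Subtype.val h2
  ext1
  simp only [LinearMap.comp_apply, Submodule.subtype_apply, LinearMap.codRestrict_apply,
    LinearMap.rangeRestrict, LinearMap.id_apply] at h1 h3 ⊢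
  rw [h1, h3]

theorem Matrix.mulVec_eq_zero_of_rank_mul_eq {K α β γ : Type*} [Field K] [Fintype α] [Fintype β]
    [Fintype γ] {B : Matrix γ α K} {A : Matrix α β K} (h : A.rank ≤ (B * A).rank)
    {v : β → K} (hv : (B * A).mulVec v = 0) : A.mulVec v = 0 := by
  have hle : LinearMap.ker A.mulVecLin ≤ LinearMap.ker (B * A).mulVecLin := fun w hw => by
    simp only [LinearMap.mem_ker, Matrix.mulVecLin_apply] at hw ⊢
    rw [← Matrix.mulVec_mulVec, hw, Matrix.mulVec_zero]
  have h1 := A.mulVecLin.finrank_range_add_finrank_ker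
  have h2 := (B * A).mulVecLin.finrank_range_add_finrank_ker
  have heq := Submodule.eq_of_le_of_finrank_le hle (by
    unfold Matrix.rank at h
    omega)
  have : v ∈ LinearMap.ker A.mulVecLin := by
    rw [heq]
    exact hv
  exact this

/-- Near a point `x`, a polynomial matrix `A` agrees, up to left multiplication by a
constant matrix `B` preserving the rank of `A(x)`, with `A(x)` times a polynomial square matrix `T`
with `T(x) = 1`. -/
theorem exists_rank_frame {α β : Type*} [Fintype α] [Fintype β] [DecidableEq β]
    (A : Matrix α β (PolyR n)) (x : Fin n → ℂ) :
    ∃ (B : Matrix β α ℂ) (T : Matrix β β (PolyR n)), T.map (eval x) = 1 ∧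
      (∀ y, B * A.map (eval x) * T.map (eval y) = B * A.map (eval y)) ∧
      ∀ y, eval y T.det ≠ 0 → (B * A.map (eval y)).rank = (A.map (eval x)).rank := by
  obtain ⟨B, hB, hB'⟩ := (A.map (eval x)).exists_reflexive_inverse
  have hC : ∀ {γ δ : Type _} (E : Matrix γ δ ℂ) (y),
      (E.map (C : ℂ →+* PolyR n)).map (eval y) = E := fun E y => by
    ext; simp
  have hT : ∀ y,
      (1 - (B * A.map (eval x)).map C + (B.map C : Matrix β α (PolyR n)) * A).map (eval y) =
      1 - B * A.map (eval x) + B * A.map (eval y) := fun y => by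
    rw [Matrix.map_add _ (map_add _), Matrix.map_sub _ (map_sub _), Matrix.map_one _ (map_zero _)
      (map_one _), hC, Matrix.map_mul]
    congr 2
    ext; simp
  have hmul : ∀ y, B * A.map (eval x) *
      (1 - (B * A.map (eval x)).map C + (B.map C : Matrix β α (PolyR n)) * A).map (eval y) =
        B * A.map (eval y) := fun y => by
    rw [hT, Matrix.mul_add, Matrix.mul_sub, ← Matrix.mul_assoc _ B, ← Matrix.mul_assoc _ B, hB',
      Matrix.mul_one, sub_self, zero_add]
  refine ⟨B, 1 - (B * A.map (eval x)).map C + (B.map C : Matrix β α (PolyR n)) * A,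
    by rw [hT, sub_add_cancel], hmul, fun y hy => ?_⟩
  rw [← hmul, Matrix.rank_mul_eq_left_of_isUnit_det]
  · refine le_antisymm (Matrix.rank_mul_le_right _ _) ?_
    conv_lhs => rw [← hB, Matrix.mul_assoc]
    exact Matrix.rank_mul_le_right _ _
  · rw [RingHom.map_det] at hy
    exact hy.isUnit

/-- If the localization of a quotient of a free module at `p` is projective, then the quotient map
splits up to a power of `p`. -/
theorem exists_splitting_of_projective_localizedModule {R κ : Type*} [CommRing R] [IsDomain R]
    [Fintype κ] [DecidableEq κ] (L : Submodule R (κ → R)) {p : R} (hp : p ≠ 0)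
    (hproj : Module.Projective (Localization.Away p)
      (LocalizedModule (Submonoid.powers p) ((κ → R) ⧸ L))) :
    ∃ (N : ℕ) (W : κ → κ → R), (∀ a ∈ L, ∀ j, ∑ i, a i * W i j = 0) ∧
      ∀ i, p ^ N • Pi.single i 1 - W i ∈ L := by
  let P := Submonoid.powers p
  let Rp := Localization P
  let π : (κ → R) →ₗ[R] LocalizedModule P ((κ → R) ⧸ L) :=
    LocalizedModule.mkLinearMap P _ ∘ₗ L.mkQ
  have hπ : ∀ a, π a = 0 ↔ ∃ k, p ^ k • a ∈ L := fun a => by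
    change LocalizedModule.mkLinearMap P _ (L.mkQ a) = 0 ↔ _
    rw [IsLocalizedModule.eq_zero_iff P]
    constructor
    · rintro ⟨⟨_, k, rfl⟩, hk⟩
      exact ⟨k, (Submodule.Quotient.mk_eq_zero L).mp hk⟩
    · rintro ⟨k, hk⟩
      exact ⟨⟨_, k, rfl⟩, (Submodule.Quotient.mk_eq_zero L).mpr hk⟩
  let π' : (κ → Rp) →ₗ[Rp] LocalizedModule P ((κ → R) ⧸ L) :=
    Fintype.linearCombination Rp fun i => π (Pi.single i 1)
  have hπ' : ∀ a : κ → R, π' (fun i => algebraMap R Rp (a i)) = π a := fun a => by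
    conv_rhs => rw [pi_eq_sum_univ' a]
    simp only [π', Fintype.linearCombination_apply, algebraMap_smul, map_sum, map_smul]
  have hsurj : Function.Surjective π' := fun y => by
    obtain ⟨⟨z, s⟩, hz⟩ := IsLocalizedModule.surj P (LocalizedModule.mkLinearMap P _) y
    obtain ⟨a, rfl⟩ := L.mkQ_surjective z
    refine ⟨IsLocalization.mk' Rp 1 s • fun i => algebraMap R Rp (a i), ?_⟩
    rw [map_smul, hπ']
    change _ • LocalizedModule.mkLinearMap P _ (L.mkQ a) = _
    rw [← hz, Submonoid.smul_def, ← algebraMap_smul Rp (s : R) y, smul_smul, IsLocalization.mk'_spec,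
      map_one, one_smul]
  obtain ⟨σ, hσ⟩ := Module.projective_lifting_property π' LinearMap.id hsurj
  obtain ⟨⟨_, e, rfl⟩, hb⟩ := IsLocalization.exist_integer_multiples_of_finite P
    fun ij : κ × κ => σ (π (Pi.single ij.1 1)) ij.2
  choose W₀ hW₀ using hb
  have hW₀' : ∀ i j, algebraMap R Rp (W₀ (i, j)) = p ^ e • σ (π (Pi.single i 1)) j :=
    fun i j => hW₀ (i, j)
  have hker : ∀ i, π (p ^ e • Pi.single i 1 - fun j => W₀ (i, j)) = 0 := fun i => by
    rw [map_sub, ← hπ' fun j => W₀ (i, j), map_smul]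
    have : (fun j => algebraMap R Rp (W₀ (i, j))) =
        algebraMap R Rp (p ^ e) • σ (π (Pi.single i 1)) := by
      ext j
      rw [hW₀', algebraMap_smul]
      rfl
    rw [this, map_smul, algebraMap_smul]
    have := LinearMap.congr_fun hσ (π (Pi.single i 1))
    simp only [LinearMap.comp_apply, LinearMap.id_apply] at this
    rw [this, sub_self]
  choose k hk using fun i => (hπ _).mp (hker i)
  refine ⟨(∑ i, k i) + e, fun i j => p ^ (∑ i, k i) * W₀ (i, j), fun a ha j => ?_, fun i => ?_⟩
  · have hinj : Function.Injective (algebraMap R Rp) :=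
      IsLocalization.injective Rp (powers_le_nonZeroDivisors_of_noZeroDivisors hp)
    apply hinj
    have h0 : π a = 0 := (hπ a).mpr ⟨0, by simpa using ha⟩
    have h1 : ∑ i, a i • σ (π (Pi.single i 1)) = 0 := by
      rw [← map_zero σ, ← h0, ← hπ' a]
      simp only [π', Fintype.linearCombination_apply, algebraMap_smul, map_sum,
        LinearMap.map_smul_of_tower]
    have h2 := congrFun h1 j
    simp only [Finset.sum_apply, Pi.smul_apply, Pi.zero_apply] at h2
    have h3 : ∑ i, a i * W₀ (i, j) = 0 := hinj <| by
      simp only [map_sum, map_mul, hW₀', map_zero]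
      rw [← smul_zero (p ^ e), ← h2, Finset.smul_sum]
      exact Finset.sum_congr rfl fun i _ => by
        rw [← algebraMap_smul Rp (a i), smul_eq_mul, mul_smul_comm]
    have h4 : ∑ i, a i * (p ^ (∑ i, k i) * W₀ (i, j)) =
        p ^ (∑ i, k i) * ∑ i, a i * W₀ (i, j) := by
      rw [Finset.mul_sum]
      exact Finset.sum_congr rfl fun i _ => by ring
    rw [h4, h3, mul_zero]
  · obtain ⟨l, hl⟩ := exists_add_of_le
      (Finset.single_le_sum (fun i _ => Nat.zero_le (k i)) (Finset.mem_univ i))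
    have : p ^ ((∑ i, k i) + e) • Pi.single i 1 - (fun j => p ^ (∑ i, k i) * W₀ (i, j)) =
        p ^ l • p ^ k i • (p ^ e • Pi.single i (1 : R) - fun j => W₀ (i, j)) := by
      rw [hl]
      ext j
      simp only [Pi.sub_apply, Pi.smul_apply, smul_eq_mul]
      ring
    rw [this]
    exact L.smul_mem _ (hk i)

/-- The matrix of the critical equations with denominators cleared. -/
def critMatrix [DecidableEq ι] (f : ι → PolyR n) : Matrix (Fin n) ι (PolyR n) :=
  Matrix.of fun i j => pderiv i (f j) * ∏ k ∈ Finset.univ.erase j, f k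

theorem critMatrix_mem_logDer [DecidableEq ι] (f : ι → PolyR n) (i : Fin n) :
    critMatrix f i ∈ logDer f := by
  refine ⟨Pi.single i (-∏ k, f k), fun j => ?_⟩
  rw [Finset.sum_eq_single i (fun l _ hl => by simp [hl]) (by simp), Pi.single_eq_same,
    ← Finset.prod_erase_mul _ _ (Finset.mem_univ j)]
  simp only [critMatrix, Matrix.of_apply]
  ring

theorem mem_critLocus_iff [DecidableEq ι] {f : ι → PolyR n} {x : Fin n → ℂ} {s : ι → ℂ} :
    (x, s) ∈ critLocus f ↔ (∀ j, eval x (f j) ≠ 0) ∧ (jacAt f x).rank = jacMaxRank f ∧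
      ((critMatrix f).map (eval x)).mulVec s = 0 := by
  simp only [critLocus, Set.mem_ofPred_eq]
  refine and_congr_right fun _ => and_congr_right fun _ => ?_
  rw [funext_iff]
  refine forall_congr' fun i => ?_
  simp only [critMatrix, Matrix.mulVec, dotProduct, Matrix.map_apply, Matrix.of_apply, map_mul,
    map_prod, Pi.zero_apply]
  rw [Finset.sum_congr rfl fun j _ => _]
  intro j _
  ring

theorem rank_critMatrix_map_eval [DecidableEq ι] {f : ι → PolyR n} {x : Fin n → ℂ}
    (hx : ∀ j, eval x (f j) ≠ 0) :
    ((critMatrix f).map (eval x)).rank = (jacAt f x).rank := by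
  have h : (critMatrix f).map (eval x) =
      (jacAt f x).transpose * Matrix.diagonal fun j => ∏ k ∈ Finset.univ.erase j, eval x (f k) := by
    ext i j
    simp [critMatrix, jacAt, Matrix.mul_diagonal]
  rw [h, Matrix.rank_mul_eq_left_of_isUnit_det, Matrix.rank_transpose]
  rw [Matrix.det_diagonal]
  exact (Finset.prod_ne_zero_iff.mpr fun j _ => Finset.prod_ne_zero_iff.mpr fun k _ => hx k).isUnit

theorem bddAbove_range_rank_jacAt {κ : Type} (f : κ → PolyR n) :
    BddAbove (Set.range fun x : Fin n → ℂ => (jacAt f x).rank) :=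
  ⟨n, by rintro _ ⟨x, rfl⟩; exact (jacAt f x).rank_le_card_width.trans_eq (Fintype.card_fin n)⟩

theorem rank_jacAt_le {κ : Type} (f : κ → PolyR n) (x : Fin n → ℂ) : (jacAt f x).rank ≤ jacMaxRank f :=
  le_ciSup (bddAbove_range_rank_jacAt f) x

theorem exists_rank_jacAt_eq {κ : Type} (f : κ → PolyR n) : ∃ x, (jacAt f x).rank = jacMaxRank f :=
  Nat.sSup_mem (Set.range_nonempty _) (bddAbove_range_rank_jacAt f)

theorem preLikelihoodIdeal_le_likelihoodIdeal [DecidableEq ι] (f : ι → PolyR n) :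
    preLikelihoodIdeal f ≤ likelihoodIdeal f := by
  refine Ideal.span_le.mpr ?_
  rintro _ ⟨a, ⟨b, hb⟩, rfl⟩ ⟨x, s⟩ ⟨hx, -, hs⟩
  dsimp only at hx hs ⊢
  have hF : ∏ k, eval x (f k) ≠ 0 := Finset.prod_ne_zero_iff.mpr fun k _ => hx k
  refine (mul_eq_zero.mp ?_).resolve_left hF
  have hb' : ∀ i, eval x (a i) * eval x (f i) =
      -∑ j, eval x (b j) * eval x (pderiv j (f i)) := fun i => by
    have := congrArg (eval x) (hb i)
    simp only [map_add, map_mul, map_sum, map_zero] at this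
    linear_combination this
  calc (∏ k, eval x (f k)) *
        eval (Sum.elim x s) (∑ i, rename Sum.inl (a i) * X (Sum.inr i))
      = ∑ i, (eval x (a i) * eval x (f i)) * (s i * ∏ k ∈ Finset.univ.erase i, eval x (f k)) := by
        rw [map_sum, Finset.mul_sum]
        refine Finset.sum_congr rfl fun i _ => ?_
        rw [← Finset.prod_erase_mul _ _ (Finset.mem_univ i), map_mul, eval_rename, eval_X,
          Sum.elim_comp_inl, Sum.elim_inr]
        ring
    _ = -∑ j, eval x (b j) * ∑ i, s i * eval x (pderiv j (f i)) *
          ∏ k ∈ Finset.univ.erase i, eval x (f k) := by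
        simp only [hb', Finset.mul_sum, Finset.sum_mul, neg_mul, Finset.sum_neg_distrib]
        rw [Finset.sum_comm]
        congr 1
        exact Finset.sum_congr rfl fun j _ => Finset.sum_congr rfl fun i _ => by ring
    _ = 0 := by simp [hs]

/-- The likelihood ideal is saturated with respect to nonzero polynomials in `x`. -/
theorem mem_likelihoodIdeal_of_mul_mem [DecidableEq ι] {f : ι → PolyR n} (hf : ∀ i, f i ≠ 0)
    {q : PolyR n} (hq : q ≠ 0) {g : PolyRS n ι}
    (h : rename Sum.inl q * g ∈ likelihoodIdeal f) : g ∈ likelihoodIdeal f := by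
  rintro ⟨x, s⟩ hxs
  obtain ⟨hx, hr, hs⟩ := mem_critLocus_iff.mp hxs
  obtain ⟨B, T, hT, hBT, hrank⟩ := exists_rank_frame (critMatrix f) x
  let S : ι → PolyR n := T.adjugate.mulVec fun i => C (s i)
  have hS : ∀ y, (fun i => eval y (S i)) = (T.adjugate.map (eval y)).mulVec s := fun y => by
    ext i
    simp [S, Matrix.mulVec, dotProduct]
  let G : PolyR n := aeval (Sum.elim X S) g
  have hG : ∀ y, eval y G = eval (Sum.elim y fun i => eval y (S i)) g := fun y => by
    rw [MvPolynomial.eval_aeval_eq]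
    congr 2
    ext (i | i) <;> simp
  have hdet : T.det ≠ 0 := fun h0 => by
    have := RingHom.map_det (eval x) T
    rw [h0, RingHom.mapMatrix_apply, hT] at this
    simp at this
  have hG0 : G = 0 := by
    refine MvPolynomial.eq_zero_of_eval_eq_zero_of_ne (q := T.det * q * ∏ i, f i)
      (mul_ne_zero (mul_ne_zero hdet hq) (Finset.prod_ne_zero_iff.mpr fun i _ => hf i))
      fun y hy => ?_
    simp only [map_mul, map_prod, mul_ne_zero_iff, Finset.prod_ne_zero_iff, Finset.mem_univ,
      true_imp_iff] at hy
    obtain ⟨⟨hy1, hy2⟩, hy3⟩ := hy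
    have hr1 := hrank y hy1
    rw [rank_critMatrix_map_eval hx, hr] at hr1
    have hr2 : jacMaxRank f ≤ (jacAt f y).rank := by
      rw [← hr1, ← rank_critMatrix_map_eval hy3]
      exact Matrix.rank_mul_le_right _ _
    have hmem : (y, fun i => eval y (S i)) ∈ critLocus f := by
      refine mem_critLocus_iff.mpr ⟨hy3, (rank_jacAt_le f y).antisymm hr2, ?_⟩
      refine Matrix.mulVec_eq_zero_of_rank_mul_eq (B := B) ?_ ?_
      · rw [hr1, rank_critMatrix_map_eval hy3]
        exact rank_jacAt_le f y
      · have hadj : T.map (eval y) * T.adjugate.map (eval y) = eval y T.det • 1 := by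
          rw [← Matrix.map_mul, Matrix.mul_adjugate]
          ext i j
          by_cases hij : i = j <;> simp [hij]
        rw [hS, Matrix.mulVec_mulVec, ← hBT, Matrix.mul_assoc, hadj, Matrix.mul_smul,
          Matrix.mul_one, Matrix.smul_mulVec, ← Matrix.mulVec_mulVec, hs, Matrix.mulVec_zero,
          smul_zero]
    have := h _ hmem
    simp only [map_mul, eval_rename, Sum.elim_comp_inl] at this
    rw [hG]
    exact (mul_eq_zero.mp this).resolve_left hy2
  have := hG x
  rw [hG0, map_zero, hS, ← RingHom.mapMatrix_apply, RingHom.map_adjugate, RingHom.mapMatrix_apply,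
    hT, Matrix.adjugate_one, Matrix.one_mulVec] at this
  exact this.symm

/-- The substitution `s_i ↦ Σ_j W_ij s_j`. -/
def substS (W : ι → ι → PolyR n) : PolyRS n ι →ₐ[ℂ] PolyRS n ι :=
  aeval (Sum.elim (fun j => X (Sum.inl j)) fun i => ∑ j, rename Sum.inl (W i j) * X (Sum.inr j))

/-- If the columns of `W` annihilate `logDer`, then substituting along `W` kills the likelihood
ideal. -/
theorem substS_eq_zero [DecidableEq ι] {f : ι → PolyR n} (hf : ∀ i, f i ≠ 0)
    {W : ι → ι → PolyR n} (hW : ∀ a ∈ logDer f, ∀ j, ∑ i, a i * W i j = 0) {g : PolyRS n ι}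
    (hg : g ∈ likelihoodIdeal f) : substS W g = 0 := by
  obtain ⟨x, hx⟩ := exists_rank_jacAt_eq f
  obtain ⟨B, T, hT, hBT, hrank⟩ :=
    exists_rank_frame (Matrix.of fun i j => pderiv j (f i) : Matrix ι (Fin n) (PolyR n)) x
  have hJ : ∀ y, (Matrix.of fun i j => pderiv j (f i) : Matrix ι (Fin n) (PolyR n)).map (eval y) =
      jacAt f y := fun _ => rfl
  simp only [hJ] at hBT hrank
  have hdet : T.det ≠ 0 := fun h0 => by
    have := RingHom.map_det (eval x) T
    rw [h0, RingHom.mapMatrix_apply, hT] at this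
    simp at this
  refine MvPolynomial.eq_zero_of_eval_eq_zero_of_ne
    (q := rename Sum.inl (T.det * ∏ i, f i)) ?_ fun z hz => ?_
  · rw [Ne, map_eq_zero_iff _ (rename_injective _ Sum.inl_injective)]
    exact mul_ne_zero hdet (Finset.prod_ne_zero_iff.mpr fun i _ => hf i)
  · obtain ⟨y, s, rfl⟩ : ∃ y s, z = Sum.elim y s := ⟨_, _, (Sum.elim_comp_inl_inr z).symm⟩
    simp only [map_mul, map_prod, eval_rename, Sum.elim_comp_inl, mul_ne_zero_iff,
      Finset.prod_ne_zero_iff, Finset.mem_univ, true_imp_iff] at hz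
    have hmem : (y, fun i => ∑ j, eval y (W i j) * s j) ∈ critLocus f := by
      refine mem_critLocus_iff.mpr ⟨hz.2, (rank_jacAt_le f y).antisymm ?_, ?_⟩
      · rw [← hx, ← hrank y hz.1]
        exact Matrix.rank_mul_le_right _ _
      · ext i
        simp only [Matrix.mulVec, dotProduct, Matrix.map_apply, Pi.zero_apply, Finset.mul_sum]
        rw [Finset.sum_comm]
        refine Finset.sum_eq_zero fun j _ => ?_
        have := congrArg (eval y) (hW _ (critMatrix_mem_logDer f i) j)
        simp only [map_sum, map_mul, map_zero] at this
        simp only [← mul_assoc, ← Finset.sum_mul, this, zero_mul]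
    rw [substS, MvPolynomial.eval_aeval_eq, ← hg _ hmem]
    congr 2
    ext (i | i) <;> simp [eval_rename]

/-- If `W` is congruent to `p ^ N` modulo `logDer`, then the kernel of the substitution along `W`
is contained in the saturation of the pre-likelihood ideal at `p`. -/
theorem exists_pow_mul_mem_preLikelihoodIdeal [DecidableEq ι] {f : ι → PolyR n} {p : PolyR n}
    {N : ℕ} {W : ι → ι → PolyR n} (hW : ∀ i, p ^ N • Pi.single i 1 - W i ∈ logDer f)
    {g : PolyRS n ι} (hg : substS W g = 0) : ∃ k : ℕ, (rename Sum.inl p) ^ k * g ∈ preLikelihoodIdeal f := by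
  let P : PolyRS n ι ⧸ preLikelihoodIdeal f := Ideal.Quotient.mk _ (rename Sum.inl p)
  let q : PolyRS n ι →ₐ[ℂ] Localization.Away P :=
    (Algebra.algHom ℂ (PolyRS n ι ⧸ preLikelihoodIdeal f) (Localization.Away P)).comp
      (Ideal.Quotient.mkₐ ℂ _)
  have hq : ∀ g, q g =
      algebraMap _ (Localization.Away P) (Ideal.Quotient.mk (preLikelihoodIdeal f) g) := fun _ => rfl
  obtain ⟨u, hu⟩ : IsUnit (q (rename Sum.inl p)) := IsLocalization.Away.algebraMap_isUnit P
  let ψ : PolyRS n ι →ₐ[ℂ] Localization.Away P :=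
    aeval (Sum.elim (fun j => q (X (Sum.inl j))) fun i => ↑(u ^ N)⁻¹ * q (X (Sum.inr i)))
  have hψ : ∀ a : PolyR n, ψ (rename Sum.inl a) = q (rename Sum.inl a) := fun a => by
    have : ψ.comp (rename Sum.inl) = q.comp (rename Sum.inl) := by
      ext j
      simp [ψ]
    exact DFunLike.congr_fun this a
  have hcomp : ψ.comp (substS W) = q := by
    ext j
    rcases j with j | i
    · simp [substS, ψ]
    · have h0 : q (∑ j, rename Sum.inl ((p ^ N • Pi.single i 1 - W i : ι → PolyR n) j) *
          X (Sum.inr j)) = 0 := by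
        rw [hq, Ideal.Quotient.eq_zero_iff_mem.mpr, map_zero]
        exact Ideal.subset_span ⟨_, hW i, rfl⟩
      have h1 : (u : Localization.Away P) ^ N * q (X (Sum.inr i)) =
          ∑ j, q (rename Sum.inl (W i j)) * q (X (Sum.inr j)) := by
        rw [hu]
        simp only [Pi.sub_apply, Pi.smul_apply, map_sub, sub_mul, Finset.sum_sub_distrib, map_sum,
          map_mul, smul_eq_mul, map_pow] at h0
        rw [sub_eq_zero] at h0
        rw [← h0, Finset.sum_eq_single i (fun l _ hl => by simp [hl]) (by simp)]
        simp
      have h2 : ∀ i, ψ (X (Sum.inr i)) = ↑(u ^ N)⁻¹ * q (X (Sum.inr i)) := fun i => by simp [ψ]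
      have h3 : substS W (X (Sum.inr i)) = ∑ j, rename Sum.inl (W i j) * X (Sum.inr j) := by
        simp [substS]
      rw [AlgHom.comp_apply, h3, map_sum]
      simp only [map_mul, hψ, h2, mul_left_comm _ (Units.val _), ← Finset.mul_sum, ← h1]
      rw [← Units.val_pow_eq_pow_val, Units.inv_mul_cancel_left]
  have h0 : q g = 0 := by rw [← hcomp, AlgHom.comp_apply, hg, map_zero]
  rw [hq, IsLocalization.map_eq_zero_iff (Submonoid.powers P)] at h0
  obtain ⟨⟨_, k, rfl⟩, hk⟩ := h0
  refine ⟨k, Ideal.Quotient.eq_zero_iff_mem.mp ?_⟩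
  rw [map_mul, map_pow]
  exact hk

/-- If `p ∈ R` is a nonzero element such that the localization
`M(A)[p⁻¹]` of the likelihood module is free over `R[p⁻¹]`, then the likelihood ideal is
the saturation of the pre-likelihood ideal at `p`:
`I(A) = I₀(A) : p^∞ = {g : p^k·g ∈ I₀(A) for some k}`. -/
theorem statement7 {n m : ℕ} (hmn : n < m) (f : Fin m → PolyR n) (d : Fin m → ℕ)
    (hne : ∀ i, f i ≠ 0)
    (hhom : ∀ i, (f i).IsHomogeneous (d i))
    (hd : ∀ i, 0 < d i)
    (hcop : ∀ i j, i ≠ j → IsRelPrime (f i) (f j))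
    (p : PolyR n) (hp : p ≠ 0)
    (hfree : Module.Free (Localization.Away p)
      (LocalizedModule (Submonoid.powers p) ((Fin m → PolyR n) ⧸ logDer f))) :
    ∀ g : PolyRS n (Fin m),
      g ∈ likelihoodIdeal f ↔
        ∃ k : ℕ, (rename Sum.inl p) ^ k * g ∈ preLikelihoodIdeal f := by
  refine fun g => ⟨fun hg => ?_, fun ⟨k, hk⟩ => ?_⟩
  · obtain ⟨N, W, hW, hW'⟩ :=
      exists_splitting_of_projective_localizedModule (logDer f) hp inferInstance
    exact exists_pow_mul_mem_preLikelihoodIdeal hW' (substS_eq_zero hne hW hg)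
  · rw [← map_pow] at hk
    exact mem_likelihoodIdeal_of_mul_mem hne (pow_ne_zero k hp)
      (preLikelihoodIdeal_le_likelihoodIdeal f hk)

end
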